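/- arXiv:math/0211094 — 2 statements merged into one kernel-verified Lean document; each statement's English description precedes it below -/
import Mathlib

section
/- Let A, B : ℤⁿ → ℤⁿ be ℤ-module automorphisms, extended to ℝ-linear automorphisms of ℝⁿ. Let v₁, …, vₙ ∈ ℤⁿ be primitive vectors (vᵢ ≠ 0 and vᵢ = d • w with d ∈ ℤ, w ∈ ℤⁿ implies d is a unit) that are linearly independent over ℝ. Suppose that for each i there exists a real number cᵢ > 0 with A(vᵢ) = cᵢ • B(vᵢ), i.e. A and B map the ray ℝ≥0·vᵢ onto the same ray. Then A = B. -/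
/-- Two primitive integer vectors that are positive real multiples of each other are equal. -/
theorem eq_of_primitive_of_eq_pos_smul {ι : Type*} {x y : ι → ℤ}
    (hx : ∀ (d : ℤ) (w : ι → ℤ), x = d • w → IsUnit d) (hy0 : y ≠ 0)
    (hy : ∀ (d : ℤ) (w : ι → ℤ), y = d • w → IsUnit d) {c : ℝ} (hc : 0 < c)
    (h : (fun j => (x j : ℝ)) = c • fun j => (y j : ℝ)) : x = y := by
  have hk (k : ι) : (x k : ℝ) = c * y k := congrFun h k
  obtain ⟨j, hj⟩ := Function.ne_iff.mp hy0
  have hj : y j ≠ 0 := hj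
  have hcross (k : ι) : y j * x k = x j * y k := by
    have : (y j * x k : ℝ) = x j * y k := by rw [hk k, hk j]; ring
    exact_mod_cast this
  obtain ⟨g, a, b, hg, hab, ha, hb⟩ := Int.exists_gcd_one' (Int.gcd_pos_of_ne_zero_left (x j) hj)
  have hg0 : (g : ℤ) ≠ 0 := by positivity
  have hred (k : ι) : a * x k = b * y k := by
    refine mul_left_cancel₀ hg0 ?_
    have := hcross k
    rw [ha, hb] at this
    linear_combination this
  have hcop : IsCoprime a b := Int.isCoprime_iff_gcd_eq_one.mpr hab
  have hbx (k : ι) : b ∣ x k := hcop.symm.dvd_of_dvd_mul_left ⟨y k, hred k⟩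
  have hay (k : ι) : a ∣ y k := hcop.dvd_of_dvd_mul_left ⟨x k, (hred k).symm⟩
  choose x' hx' using hbx
  choose y' hy' using hay
  have hbu := hx b x' (funext hx')
  have hau := hy a y' (funext hy')
  have hpos : (0 : ℝ) < x j * y j := by
    have : (y j : ℝ) ≠ 0 := by exact_mod_cast hj
    rw [hk j, mul_assoc]
    exact mul_pos hc (mul_self_pos.mpr this)
  have hpos : 0 < x j * y j := by exact_mod_cast hpos
  have hne : a ≠ -b := by
    rintro rfl
    rw [ha, hb] at hpos
    nlinarith [sq_nonneg (b * (g : ℤ))]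
  have hab : a = b := by
    rcases Int.isUnit_iff.mp hau with h₁ | h₁ <;> rcases Int.isUnit_iff.mp hbu with h₂ | h₂ <;> omega
  funext k
  exact mul_left_cancel₀ hau.ne_zero (by rw [hred k, hab])

/-- Linear maps out of `ℤⁿ` to `ℤᵐ` agreeing on `n` real-linearly independent vectors are equal. -/
theorem linearMap_ext_of_linearIndependent_real {ι κ : Type*} [Fintype ι] [DecidableEq ι]
    {f g : (ι → ℤ) →ₗ[ℤ] (κ → ℤ)} {v : ι → ι → ℤ}
    (hli : LinearIndependent ℝ fun i => fun j => ((v i j : ℤ) : ℝ))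
    (h : ∀ i, f (v i) = g (v i)) : f = g := by
  have hunit : IsUnit ((Matrix.of v).map (Int.castRingHom ℝ)) :=
    Matrix.linearIndependent_rows_iff_isUnit.mp hli
  have hdet : (Matrix.of v).det ≠ 0 := by
    intro h0
    have := ((Matrix.isUnit_iff_isUnit_det _).mp hunit).ne_zero
    rw [← RingHom.mapMatrix_apply, ← RingHom.map_det, h0, map_zero] at this
    exact this rfl
  refine sub_eq_zero.mp (LinearMap.pi_ext' fun i => LinearMap.ext_ring (funext fun k => ?_))
  have hcol : (fun l => (f - g) (Pi.single l 1) k) = 0 := by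
    refine Matrix.eq_zero_of_mulVec_eq_zero hdet (funext fun l => ?_)
    have hl : (f - g) (v l) k = 0 := by simp [h l]
    rw [LinearMap.pi_apply_eq_sum_univ (f - g) (v l)] at hl
    have hsingle (l : ι) : (fun j => if l = j then (1 : ℤ) else 0) = Pi.single l 1 := by
      ext j
      simp [Pi.single_apply, eq_comm]
    simpa [Matrix.mulVec, dotProduct, hsingle] using hl
  exact congrFun hcol i

/-- Two `ℤ`-module automorphisms of `ℤⁿ` whose real extensions map each ray
`ℝ≥0·vᵢ`, for primitive `ℝ`-linearly independent vectors `v₁, …, vₙ`, onto the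
same ray, are equal. -/
theorem stmt_12 {n : ℕ} (A B : (Fin n → ℤ) ≃ₗ[ℤ] (Fin n → ℤ))
    (v : Fin n → (Fin n → ℤ))
    (hprim : ∀ i, v i ≠ 0 ∧ ∀ (d : ℤ) (w : Fin n → ℤ), v i = d • w → IsUnit d)
    (hli : LinearIndependent ℝ fun i => fun j => ((v i j : ℤ) : ℝ))
    (hray : ∀ i, ∃ c : ℝ, 0 < c ∧
      (fun j => ((A (v i)) j : ℝ)) = c • fun j => ((B (v i)) j : ℝ)) :
    A = B := by
  have hprim_map (C : (Fin n → ℤ) ≃ₗ[ℤ] (Fin n → ℤ)) (i : Fin n) (d : ℤ) (w : Fin n → ℤ)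
      (h : C (v i) = d • w) : IsUnit d :=
    (hprim i).2 d (C.symm w) (by rw [← map_smul, ← h, C.symm_apply_apply])
  refine LinearEquiv.toLinearMap_injective (linearMap_ext_of_linearIndependent_real hli fun i => ?_)
  obtain ⟨c, hc, h⟩ := hray i
  exact eq_of_primitive_of_eq_pos_smul (hprim_map A i) (B.map_ne_zero_iff.mpr (hprim i).1)
    (hprim_map B i) hc h
end

section
/- Let d, d' : ℝⁿ → ℝᵐ be differentiable maps and R ∈ ℝ. Suppose that for every b ∈ ℝⁿ and every real r > R, the linear map r • Dd(b) + Dd'(b) : ℝⁿ → ℝᵐ is injective, where Dd(b) and Dd'(b) denote the (Fréchet) derivatives. Define d̄ : ℝⁿ × ℝ → ℝᵐ × ℝ by d̄(b, r) = (r • d(b) + d'(b), r). Then d̄ is differentiable, and for every b ∈ ℝⁿ and r > R, the derivative of d̄ at (b, r) is injective. -/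
/-- The Fréchet derivative of `(b, r) ↦ (r • f b + g b, r)`. -/
theorem HasFDerivAt.snd_smul_add_prodMk {E F : Type*} [NormedAddCommGroup E] [NormedSpace ℝ E]
    [NormedAddCommGroup F] [NormedSpace ℝ F] {f g : E → F} {f' g' : E →L[ℝ] F} {b : E}
    (hf : HasFDerivAt f f' b) (hg : HasFDerivAt g g' b) (r : ℝ) :
    HasFDerivAt (fun p : E × ℝ => (p.2 • f p.1 + g p.1, p.2))
      (((r • f'.comp (.fst ℝ E ℝ) + (ContinuousLinearMap.snd ℝ E ℝ).smulRight (f b)) +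
        g'.comp (.fst ℝ E ℝ)).prod (.snd ℝ E ℝ)) (b, r) := by
  have hfst : HasFDerivAt Prod.fst (ContinuousLinearMap.fst ℝ E ℝ) (b, r) := hasFDerivAt_fst
  have hsnd : HasFDerivAt Prod.snd (ContinuousLinearMap.snd ℝ E ℝ) (b, r) := hasFDerivAt_snd
  exact ((hsnd.smul (HasFDerivAt.comp (b, r) hf hfst)).add
    (HasFDerivAt.comp (b, r) hg hfst)).prodMk hsnd


/-- If `d, d' : ℝⁿ → ℝᵐ` are differentiable and `r • Dd(b) + Dd'(b)` is injective
for all `b` and all `r > R`, then `d̄(b, r) = (r • d(b) + d'(b), r)` is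
differentiable and its derivative is injective at every `(b, r)` with `r > R`. -/
theorem stmt_13 {n m : ℕ} (R : ℝ) (d d' : (Fin n → ℝ) → (Fin m → ℝ))
    (hd : Differentiable ℝ d) (hd' : Differentiable ℝ d')
    (hinj : ∀ b : Fin n → ℝ, ∀ r : ℝ, R < r →
      Function.Injective fun u : Fin n → ℝ =>
        r • fderiv ℝ d b u + fderiv ℝ d' b u) :
    Differentiable ℝ
        (fun p : (Fin n → ℝ) × ℝ => (p.2 • d p.1 + d' p.1, p.2)) ∧
      ∀ (b : Fin n → ℝ) (r : ℝ), R < r →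
        Function.Injective
          ⇑(fderiv ℝ (fun p : (Fin n → ℝ) × ℝ => (p.2 • d p.1 + d' p.1, p.2)) (b, r)) := by
  have key := fun (b : Fin n → ℝ) (r : ℝ) =>
    (hd b).hasFDerivAt.snd_smul_add_prodMk (hd' b).hasFDerivAt r
  refine ⟨fun p => (key p.1 p.2).differentiableAt, fun b r hr => ?_⟩
  rw [(key b r).fderiv]
  rintro ⟨u, s⟩ ⟨v, t⟩ h
  obtain ⟨h₁, rfl : s = t⟩ := Prod.ext_iff.mp h
  have huv : u = v := by
    refine hinj b r hr (add_right_cancel (b := s • d b) ?_)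
    dsimp only
    rw [add_right_comm, add_right_comm _ _ (s • d b)]
    exact h₁
  rw [huv]
end
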